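/- In the finite-dimensional-negative-part setting, assume N : H → H is bounded, demicontinuous, quasi-monotone and sublinear: lim_{k→∞} ‖N(u_k)‖/‖u_k‖ = 0 for every sequence {u_k} ⊂ H with ‖u_k‖ → +∞. Then for every 0 < ε < 1 and every h ∈ H the perturbed equation ε P₂u + Lu + N(u) = h has a solution u ∈ dom L. -/

import Mathlib

open Filter Topology

open Polynomial in
theorem Matrix.exists_polynomial_eval_eq_det_one_add_smul {K n : Type*} [Field K] [Fintype n]
    [DecidableEq n] (M : Matrix n n K) :
    ∃ p : K[X], p.natDegree ≤ Fintype.card n ∧ ∀ t : K, p.eval t = (1 + t • M).det := by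
  have h := Polynomial.natDegree_det_X_add_C_le M 1
  refine ⟨_, h, fun t => ?_⟩
  rw [← Polynomial.coe_evalRingHom, RingHom.map_det]
  congr 1
  ext i j
  by_cases hij : i = j
  · subst hij
    simp [add_comm, mul_comm t]
  · simp [Matrix.one_apply_ne hij, mul_comm t]

open Polynomial in
theorem LinearMap.exists_polynomial_eval_eq_det_one_add_smul {K V : Type*} [Field K]
    [AddCommGroup V] [Module K V] [FiniteDimensional K V] (A : V →ₗ[K] V) :
    ∃ p : K[X], p.natDegree ≤ Module.finrank K V ∧
      ∀ t : K, p.eval t = LinearMap.det (1 + t • A) := by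
  have b := Module.finBasis K V
  obtain ⟨p, hp, hpe⟩ := (LinearMap.toMatrix b b A).exists_polynomial_eval_eq_det_one_add_smul
  refine ⟨p, by simpa using hp, fun t => ?_⟩
  rw [hpe, ← LinearMap.det_toMatrix b, map_add, map_smul, LinearMap.toMatrix_one]

open Polynomial in
theorem LinearMap.exists_det_one_add_eq_sum {K V : Type*} [Field K]
    [AddCommGroup V] [Module K V] [FiniteDimensional K V] {v : ℕ → K} (hv : Function.Injective v) :
    ∃ (n : ℕ) (c : ℕ → K), ∑ i ∈ Finset.range n, c i = 1 ∧
      ∀ A : V →ₗ[K] V, LinearMap.det (1 + A) =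
        ∑ i ∈ Finset.range n, LinearMap.det (1 + v i • A) * c i := by
  classical
  set s := Finset.range (Module.finrank K V + 1) with hs
  refine ⟨Module.finrank K V + 1, fun i => (Lagrange.basis s v i).eval 1, ?_, fun A => ?_⟩
  · rw [← Polynomial.eval_finsetSum, Lagrange.sum_basis hv.injOn (by simp)]
    simp
  · obtain ⟨p, hp, hpe⟩ := A.exists_polynomial_eval_eq_det_one_add_smul
    have hdeg : p.degree < s.card := by
      refine (Polynomial.degree_le_of_natDegree_le hp).trans_lt ?_
      rw [hs, Finset.card_range]
      exact_mod_cast Nat.lt_succ_self _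
    have h1 := congrArg (Polynomial.eval 1) (Lagrange.eq_interpolate hv.injOn hdeg)
    rw [hpe, one_smul, Lagrange.interpolate_apply, Polynomial.eval_finsetSum] at h1
    rw [h1]
    exact Finset.sum_congr rfl fun i _ => by simp [hpe]

theorem ContinuousLinearMap.det_one_add_pos {E : Type*} [NormedAddCommGroup E] [NormedSpace ℝ E]
    [FiniteDimensional ℝ E] {A : E →L[ℝ] E} (hA : ‖A‖ < 1) : 0 < (1 + A).det := by
  have hne : ∀ s ∈ Set.Icc (0 : ℝ) 1, (1 + s • A).det ≠ 0 := by
    intro s hs h0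
    obtain ⟨x, hx, hx0⟩ := (Submodule.ne_bot_iff _).1 (LinearMap.bot_lt_ker_of_det_eq_zero h0).ne'
    have h1 : x + s • A x = 0 := by simpa using hx
    have h2 : ‖x‖ ≤ ‖A‖ * ‖x‖ := by
      calc ‖x‖ = ‖s • A x‖ := by rw [eq_neg_of_add_eq_zero_right h1, norm_neg]
        _ = s * ‖A x‖ := by rw [norm_smul, Real.norm_of_nonneg hs.1]
        _ ≤ 1 * ‖A x‖ := by gcongr; exact hs.2
        _ ≤ ‖A‖ * ‖x‖ := by rw [one_mul]; exact A.le_opNorm x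
    have := norm_pos_iff.2 hx0
    nlinarith
  have hc : ContinuousOn (fun s : ℝ => (1 + s • A).det) (Set.Icc 0 1) :=
    (ContinuousLinearMap.continuous_det.comp (by fun_prop)).continuousOn
  by_contra! hneg
  have h01 : (1 + (0 : ℝ) • A).det = 1 := by
    simp [ContinuousLinearMap.det]
  obtain ⟨s, hs, hs0⟩ := intermediate_value_Icc' zero_le_one hc
    (show (0 : ℝ) ∈ Set.Icc _ _ from ⟨by simpa using hneg, by simp only [h01, zero_le_one]⟩)
  exact hne s hs hs0

section Brouwer

open Metric MeasureTheory

/-- If `r` is a `C¹` retraction of the closed unit ball onto the sphere, then the maps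
`x ↦ x + t • (r x - x)` are onto the open unit ball for small `t`. -/
theorem image_ball_add_smul_eq_ball {E : Type*} [NormedAddCommGroup E] [InnerProductSpace ℝ E]
    [FiniteDimensional ℝ E] {r : E → E} (hr : ∀ x ∈ closedBall (0 : E) 1, ContDiffAt ℝ 1 r x)
    (hr1 : ∀ x ∈ closedBall (0 : E) 1, ‖r x‖ = 1) (hrs : ∀ x ∈ sphere (0 : E) 1, r x = x)
    {t : ℝ} (ht0 : 0 ≤ t) (ht1 : t < 1)
    (htd : ∀ x ∈ closedBall (0 : E) 1, ‖t • fderiv ℝ (fun y => r y - y) x‖ < 1) :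
    (fun x => x + t • (r x - x)) '' ball 0 1 = ball 0 1 := by
  set φ : E → E := fun x => x + t • (r x - x) with hφ
  have hdiff : ∀ x ∈ closedBall (0 : E) 1, ContDiffAt ℝ 1 (fun y => r y - y) x := fun x hx =>
    (hr x hx).sub contDiffAt_id
  have hφd : ∀ x ∈ closedBall (0 : E) 1,
      HasStrictFDerivAt φ (1 + t • fderiv ℝ (fun y => r y - y) x) x := fun x hx =>
    (hasStrictFDerivAt_id x).add (((hdiff x hx).hasStrictFDerivAt one_ne_zero).const_smul t)
  have hmaps : ∀ x ∈ ball (0 : E) 1, φ x ∈ ball (0 : E) 1 := by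
    intro x hx
    have hx' : ‖x‖ < 1 := by simpa using hx
    have h1 : φ x = (1 - t) • x + t • r x := by simp only [hφ]; module
    have h2 : ‖φ x‖ ≤ (1 - t) * ‖x‖ + t * 1 := by
      rw [h1]
      refine (norm_add_le _ _).trans ?_
      rw [norm_smul, norm_smul, Real.norm_of_nonneg ht0, Real.norm_of_nonneg (by linarith),
        hr1 x (ball_subset_closedBall hx)]
    rw [mem_ball_zero_iff]
    nlinarith
  have hsub : φ '' ball 0 1 ⊆ ball 0 1 := by
    rintro _ ⟨x, hx, rfl⟩
    exact hmaps x hx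
  refine hsub.antisymm ?_
  have hopen : IsOpen (φ '' ball 0 1) := by
    rw [isOpen_iff_mem_nhds]
    rintro _ ⟨x, hx, rfl⟩
    have hx' := ball_subset_closedBall hx
    have hdet := (ContinuousLinearMap.det_one_add_pos (htd x hx')).ne'
    rw [← HasStrictFDerivAt.map_nhds_eq_of_equiv
      (f' := ContinuousLinearMap.toContinuousLinearEquivOfDetNeZero _ hdet)
      (by simpa using hφd x hx')]
    exact image_mem_map (isOpen_ball.mem_nhds hx)
  have hφc : ContinuousOn φ (closedBall 0 1) := fun x hx =>
    (hφd x hx).continuousAt.continuousWithinAt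
  refine (convex_ball (0 : E) 1).isPreconnected.subset_of_closure_inter_subset hopen
    ⟨φ 0, hmaps 0 (by simp), 0, by simp, rfl⟩ ?_
  rintro y ⟨hy, hyb⟩
  have hcl : closure (φ '' ball 0 1) ⊆ φ '' closedBall 0 1 :=
    closure_minimal (Set.image_mono ball_subset_closedBall)
      ((isCompact_closedBall (0 : E) 1).image_of_continuousOn hφc).isClosed
  obtain ⟨x, hx, rfl⟩ := hcl hy
  rcases (mem_closedBall_zero_iff.1 hx).lt_or_eq with h | h
  · exact ⟨x, by simpa using h, rfl⟩
  · have : φ x = x := by simp [hφ, hrs x (by simpa using h)]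
    rw [this, mem_ball_zero_iff] at hyb
    exact absurd h hyb.ne

/-- There is no continuously differentiable retraction of the closed unit ball onto the sphere. -/
theorem not_exists_contDiffAt_retraction {E : Type*} [NormedAddCommGroup E] [InnerProductSpace ℝ E]
    [FiniteDimensional ℝ E] {r : E → E} (hr : ∀ x ∈ closedBall (0 : E) 1, ContDiffAt ℝ 1 r x)
    (hr1 : ∀ x ∈ closedBall (0 : E) 1, ‖r x‖ = 1) (hrs : ∀ x ∈ sphere (0 : E) 1, r x = x) :
    False := by
  borelize E
  let μ : Measure E := Measure.addHaar
  set g : E → E := fun y => r y - y with hg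
  have hdiff : ∀ x ∈ closedBall (0 : E) 1, ContDiffAt ℝ 1 g x := fun x hx =>
    (hr x hx).sub contDiffAt_id
  have hgc : ContinuousOn (fderiv ℝ g) (closedBall 0 1) := fun x hx =>
    ((hdiff x hx).continuousAt_fderiv one_ne_zero).continuousWithinAt
  obtain ⟨C, hC⟩ := (isCompact_closedBall (0 : E) 1).exists_bound_of_continuousOn hgc
  have hC0 : 0 ≤ C := (norm_nonneg _).trans (hC 0 (by simp))
  let v : ℕ → ℝ := fun i => 1 / ((i + 2) * (C + 1))
  have hv0 : ∀ i, 0 < v i := fun i => by positivity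
  have hv1 : ∀ i, v i * (C + 1) ≤ 1 / 2 := fun i => by
    have : v i * (C + 1) = 1 / (i + 2) := by simp only [v]; field_simp
    rw [this]
    gcongr
    linarith [(Nat.cast_nonneg i : (0 : ℝ) ≤ i)]
  have hvinj : Function.Injective v := fun i j hij => by
    have hC1 : C + 1 ≠ 0 := by positivity
    have h2 : ((i : ℝ) + 2) * (C + 1) = (j + 2) * (C + 1) := by
      simpa [v] using hij
    simpa using mul_right_cancel₀ hC1 h2
  have hgd : ∀ x ∈ ball (0 : E) 1, ∀ t : ℝ,
      HasFDerivAt (fun x => x + t • g x) (1 + t • fderiv ℝ g x) x := fun x hx t =>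
    (hasFDerivAt_id x).add
      (((hdiff x (ball_subset_closedBall hx)).differentiableAt one_ne_zero).hasFDerivAt.const_smul
        t)
  have hint : ∀ i, IntegrableOn (fun x => (1 + v i • fderiv ℝ g x).det) (ball 0 1) μ ∧
      ∫ x in ball 0 1, (1 + v i • fderiv ℝ g x).det ∂μ = μ.real (ball 0 1) := by
    intro i
    have hsmall : ∀ x ∈ closedBall (0 : E) 1, ‖v i • fderiv ℝ g x‖ < 1 := by
      intro x hx
      rw [norm_smul, Real.norm_of_nonneg (hv0 i).le]
      nlinarith [hC x hx, hv0 i, hv1 i]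
    constructor
    · have hvc : ContinuousOn (fun x => v i • fderiv ℝ g x) (closedBall 0 1) :=
        hgc.const_smul (v i)
      refine IntegrableOn.mono_set ?_ (ball_subset_closedBall (x := (0 : E)) (ε := 1))
      refine ContinuousOn.integrableOn_compact (isCompact_closedBall _ _) ?_
      exact ContinuousLinearMap.continuous_det.comp_continuousOn
        (continuousOn_const.add hvc)
    · have hinj : Set.InjOn (fun x => x + v i • g x) (ball 0 1) := by
        intro x hx y hy hxy
        have hle := (convex_closedBall (0 : E) 1).norm_image_sub_le_of_norm_fderiv_le
          (fun z hz => (hdiff z hz).differentiableAt one_ne_zero) hC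
          (ball_subset_closedBall hx) (ball_subset_closedBall hy)
        have h1 : y - x = v i • (g x - g y) := by
          have : x + v i • g x = y + v i • g y := hxy
          rw [smul_sub, sub_eq_sub_iff_add_eq_add, ← this, add_comm]
        have h2 : ‖y - x‖ = v i * ‖g y - g x‖ := by
          rw [h1, norm_smul, Real.norm_of_nonneg (hv0 i).le, norm_sub_rev]
        have h3 : ‖y - x‖ ≤ 0 := by
          nlinarith [hv0 i, hv1 i, norm_nonneg (y - x), norm_nonneg (g y - g x),
            mul_le_mul_of_nonneg_left hle (hv0 i).le]
        exact (sub_eq_zero.1 (norm_le_zero_iff.1 h3)).symm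
      have himg := image_ball_add_smul_eq_ball hr hr1 hrs (hv0 i).le
        (by nlinarith [hv0 i, hv1 i]) hsmall
      have hcv := integral_image_eq_integral_abs_det_fderiv_smul μ measurableSet_ball
        (fun x hx => (hgd x hx (v i)).hasFDerivWithinAt) hinj (fun _ => (1 : ℝ))
      rw [himg] at hcv
      simp only [smul_eq_mul, mul_one, integral_const, measureReal_restrict_apply_univ] at hcv
      rw [hcv]
      exact setIntegral_congr_fun measurableSet_ball fun x hx =>
        (abs_of_pos (ContinuousLinearMap.det_one_add_pos
          (hsmall x (ball_subset_closedBall hx)))).symm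
  obtain ⟨n, c, hc, hdet⟩ := LinearMap.exists_det_one_add_eq_sum (V := E) hvinj
  have hdet0 : ∀ x ∈ ball (0 : E) 1, (1 + fderiv ℝ g x).det = 0 := by
    intro x hx
    by_contra hne
    have hrd : HasFDerivAt r (1 + fderiv ℝ g x) x := by
      simpa [hg] using hgd x hx 1
    have hsq : HasFDerivAt (fun y => ‖r y‖ ^ 2) (0 : E →L[ℝ] ℝ) x := by
      refine (hasFDerivAt_const (1 : ℝ) x).congr_of_eventuallyEq ?_
      filter_upwards [isOpen_ball.mem_nhds hx] with y hy
      simp [hr1 y (ball_subset_closedBall hy)]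
    have horth := hrd.norm_sq.unique hsq
    obtain ⟨w, hw⟩ := (ContinuousLinearMap.toContinuousLinearEquivOfDetNeZero _ hne).surjective
      (r x)
    have h0 := DFunLike.congr_fun horth w
    rw [ContinuousLinearMap.toContinuousLinearEquivOfDetNeZero_apply] at hw
    simp only [smul_apply, ContinuousLinearMap.comp_apply, hw,
      innerSL_apply_apply, real_inner_self_eq_norm_sq, hr1 x (ball_subset_closedBall hx)] at h0
    norm_num at h0
  have hsum : ∫ x in ball (0 : E) 1, (1 + fderiv ℝ g x).det ∂μ = μ.real (ball 0 1) := by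
    have : ∀ x, (1 + fderiv ℝ g x).det =
        ∑ i ∈ Finset.range n, (1 + v i • fderiv ℝ g x).det * c i := fun x => hdet _
    simp_rw [this]
    rw [integral_finsetSum _ fun i _ => (hint i).1.mul_const _]
    simp_rw [integral_mul_const, (hint _).2]
    rw [← Finset.mul_sum, hc, mul_one]
  rw [setIntegral_congr_fun measurableSet_ball hdet0, integral_zero] at hsum
  exact (ENNReal.toReal_pos (measure_ball_pos μ (0 : E) one_pos).ne' measure_ball_lt_top.ne).ne hsum

theorem exists_fixedPoint_of_contDiff {E : Type*} [NormedAddCommGroup E] [InnerProductSpace ℝ E]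
    [FiniteDimensional ℝ E] {f : E → E} (hf : ContDiff ℝ 1 f)
    (hfm : ∀ x ∈ closedBall (0 : E) 1, ‖f x‖ ≤ 1) : ∃ x ∈ closedBall (0 : E) 1, f x = x := by
  by_contra! hne
  let a : E → ℝ := fun x => ‖x - f x‖ ^ 2
  let b : E → ℝ := fun x => inner ℝ x (x - f x)
  let D : E → ℝ := fun x => b x ^ 2 + a x * (1 - ‖x‖ ^ 2)
  let lam : E → ℝ := fun x => (√(D x) - b x) / a x
  have hapos : ∀ x ∈ closedBall (0 : E) 1, 0 < a x := fun x hx =>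
    pow_pos (norm_pos_iff.2 (sub_ne_zero.2 (hne x hx).symm)) 2
  have hb1 : ∀ x ∈ sphere (0 : E) 1, 0 < b x := by
    intro x hx
    have hx1 : ‖x‖ = 1 := by simpa using hx
    have h1 := hapos x (sphere_subset_closedBall hx)
    have h2 := hfm x (sphere_subset_closedBall hx)
    simp only [a, b, norm_sub_sq_real, inner_sub_right, real_inner_self_eq_norm_sq, hx1] at h1 ⊢
    nlinarith [norm_nonneg (f x)]
  have hDpos : ∀ x ∈ closedBall (0 : E) 1, 0 < D x := by
    intro x hx
    have h1 := hapos x hx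
    rcases (mem_closedBall_zero_iff.1 hx).lt_or_eq with h | h
    · have : 0 < 1 - ‖x‖ ^ 2 := by nlinarith [norm_nonneg x]
      positivity
    · have := hb1 x (by simpa using h)
      simp only [D, h]
      norm_num
      positivity
  refine not_exists_contDiffAt_retraction (r := fun x => x + lam x • (x - f x)) ?_ ?_ ?_
  · intro x hx
    have hd : ContDiffAt ℝ 1 (fun x => x - f x) x := contDiffAt_id.sub hf.contDiffAt
    have ha : ContDiffAt ℝ 1 a x := hd.norm_sq ℝ
    have hb : ContDiffAt ℝ 1 b x := contDiffAt_id.inner ℝ hd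
    have hD : ContDiffAt ℝ 1 D x :=
      (hb.pow 2).add (ha.mul (contDiffAt_const.sub (contDiffAt_id.norm_sq ℝ)))
    have hlam : ContDiffAt ℝ 1 lam x :=
      ((hD.sqrt (hDpos x hx).ne').sub hb).div ha (hapos x hx).ne'
    exact contDiffAt_id.add (hlam.smul hd)
  · intro x hx
    have hs := Real.sq_sqrt (hDpos x hx).le
    have ha := (hapos x hx).ne'
    have h1 : ‖x + lam x • (x - f x)‖ ^ 2 = ‖x‖ ^ 2 + 2 * (lam x * b x) + lam x ^ 2 * a x := by
      rw [norm_add_sq_real, inner_smul_right, norm_smul, mul_pow, Real.norm_eq_abs, sq_abs]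
    have h2 : 2 * (lam x * b x) + lam x ^ 2 * a x = 1 - ‖x‖ ^ 2 := by
      have h3 : a x * lam x = √(D x) - b x := mul_div_cancel₀ _ ha
      apply mul_left_cancel₀ ha
      have h4 : √(D x) ^ 2 = b x ^ 2 + a x * (1 - ‖x‖ ^ 2) := hs
      have h5 : √(D x) = a x * lam x + b x := by linarith
      rw [h5] at h4
      linarith
    have h3 : ‖x + lam x • (x - f x)‖ ^ 2 = 1 := by linarith
    exact (pow_eq_one_iff_of_nonneg (norm_nonneg _) two_ne_zero).1 h3
  · intro x hx
    have hx1 : ‖x‖ = 1 := by simpa using hx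
    have : lam x = 0 := by
      simp [lam, D, hx1, Real.sqrt_sq (hb1 x hx).le]
    simp [this]

/-- **Brouwer's fixed point theorem** for maps into the closed unit ball. -/
theorem exists_fixedPoint_of_continuous_of_norm_le_one {E : Type*} [NormedAddCommGroup E]
    [InnerProductSpace ℝ E] [FiniteDimensional ℝ E] {f : E → E} (hf : Continuous f)
    (hfm : ∀ x, ‖f x‖ ≤ 1) : ∃ x ∈ closedBall (0 : E) 1, f x = x := by
  obtain ⟨x, hx, hmin⟩ := (isCompact_closedBall (0 : E) 1).exists_isMinOn ⟨0, by simp⟩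
    (f := fun x => ‖f x - x‖) (by fun_prop)
  refine ⟨x, hx, sub_eq_zero.1 (norm_le_zero_iff.1 (le_of_forall_pos_le_add fun η hη => ?_))⟩
  rw [zero_add]
  have hη2 : 0 < η / 2 := by positivity
  obtain ⟨g, hg, hgf, -⟩ := hf.exists_contDiff_approx 1 (ε := fun _ => η / 2) continuous_const
    fun _ => hη2
  have hgn : ∀ y, ‖g y‖ ≤ 1 + η / 2 := fun y => by
    have h1 := hgf y
    rw [dist_eq_norm] at h1
    linarith [norm_le_norm_add_norm_sub' (g y) (f y), hfm y]
  obtain ⟨y, hy, hfix⟩ := exists_fixedPoint_of_contDiff (f := fun y => (1 + η / 2)⁻¹ • g y)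
    (by simpa using hg.const_smul _) fun y _ => by
      rw [norm_smul, Real.norm_of_nonneg (by positivity)]
      exact inv_mul_le_one_of_le₀ (hgn y) (by positivity)
  have hgy : g y = (1 + η / 2) • y := by
    have h0 : (1 + η / 2) ≠ 0 := by positivity
    have h1 : (1 + η / 2)⁻¹ • g y = y := hfix
    rw [← smul_inv_smul₀ h0 (g y), h1]
  have h1 : ‖g y - y‖ ≤ η / 2 := by
    have : g y - y = (η / 2) • y := by rw [hgy]; module
    rw [this, norm_smul, Real.norm_of_nonneg hη2.le]
    exact mul_le_of_le_one_right hη2.le (by simpa using hy)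
  have h2 := hgf y
  rw [dist_comm, dist_eq_norm] at h2
  have h3 : ‖f x - x‖ ≤ ‖f y - y‖ := hmin hy
  linarith [norm_sub_le_norm_sub_add_norm_sub (f y) (g y) y]

/-- **Brouwer's fixed point theorem** for self-maps of a closed ball centered at the origin. -/
theorem exists_fixedPoint_of_mapsTo_closedBall {E : Type*} [NormedAddCommGroup E]
    [InnerProductSpace ℝ E] [FiniteDimensional ℝ E] {f : E → E} {R : ℝ} (hR : 0 < R)
    (hf : Continuous f) (hfm : ∀ x, ‖x‖ ≤ R → ‖f x‖ ≤ R) : ∃ x, ‖x‖ ≤ R ∧ f x = x := by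
  let p : E → E := fun x => (R * (max 1 ‖x‖)⁻¹) • x
  have hm : ∀ x : E, 0 < max 1 ‖x‖ := fun x => lt_max_of_lt_left one_pos
  have hp : Continuous p := by
    refine (continuous_const.mul (Continuous.inv₀ (by fun_prop) fun x => (hm x).ne')).smul
      continuous_id
  have hpn : ∀ x, ‖p x‖ ≤ R := fun x => by
    rw [norm_smul, Real.norm_of_nonneg (mul_nonneg hR.le (inv_nonneg.2 (hm x).le)), mul_assoc]
    exact mul_le_of_le_one_right hR.le (inv_mul_le_one_of_le₀ (le_max_right _ _) (hm x).le)
  obtain ⟨x, hx, hfx⟩ := exists_fixedPoint_of_continuous_of_norm_le_one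
    (f := fun x => R⁻¹ • f (p x)) (continuous_const.smul (hf.comp hp)) fun x => by
      rw [norm_smul, Real.norm_of_nonneg (by positivity)]
      exact inv_mul_le_one_of_le₀ (hfm _ (hpn x)) hR.le
  have hpx : p x = R • x := by
    have : max 1 ‖x‖ = 1 := max_eq_left (by simpa using hx)
    simp [p, this]
  refine ⟨p x, hpn x, ?_⟩
  rw [← smul_inv_smul₀ hR.ne' (f (p x)), hfx, hpx]

end Brouwer

section HilbertSpace

variable {H : Type*} [NormedAddCommGroup H] [InnerProductSpace ℂ H]

open scoped InnerProductSpace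

/-- The orthogonal projection onto a finite-dimensional subspace maps weakly continuous maps to
continuous ones. -/
theorem Submodule.tendsto_starProjection_of_tendsto_inner {ι : Type*} {l : Filter ι}
    (V : Submodule ℂ H) [FiniteDimensional ℂ V] {F : ι → H} {y : H}
    (hF : ∀ v : H, Tendsto (fun x => ⟪v, F x⟫_ℂ) l (𝓝 ⟪v, y⟫_ℂ)) :
    Tendsto (fun x => V.starProjection (F x)) l (𝓝 (V.starProjection y)) := by
  have key : ∀ z : H, V.starProjection z =
      ∑ i, ⟪(stdOrthonormalBasis ℂ V i : H), z⟫_ℂ • (stdOrthonormalBasis ℂ V i : H) := fun z =>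
    by simp [(stdOrthonormalBasis ℂ V).starProjection_eq_sum_rankOne]
  simp_rw [key]
  exact tendsto_finsetSum _ fun i _ => (hF _).smul_const _

/-- A bounded sequence in a separable Hilbert space has a weakly convergent subsequence. -/
theorem exists_subseq_tendsto_inner [CompleteSpace H] [TopologicalSpace.SeparableSpace H]
    {u : ℕ → H} {R : ℝ} (hu : ∀ n, ‖u n‖ ≤ R) :
    ∃ (u₀ : H) (φ : ℕ → ℕ), StrictMono φ ∧
      ∀ v : H, Tendsto (fun n => ⟪v, u (φ n)⟫_ℂ) atTop (𝓝 ⟪v, u₀⟫_ℂ) := by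
  let U : ℕ → WeakDual ℂ H := fun n => StrongDual.toWeakDual (InnerProductSpace.toDual ℂ H (u n))
  obtain ⟨a, -, φ, hφ, hlim⟩ := WeakDual.isSeqCompact_closedBall ℂ H 0 R (x := U) fun n => by
    simpa [U] using hu n
  refine ⟨(InnerProductSpace.toDual ℂ H).symm (WeakDual.toStrongDual a), φ, hφ, fun v => ?_⟩
  have h1 : Tendsto (fun n => U (φ n) v) atTop (𝓝 (a v)) :=
    ((WeakDual.eval_continuous v).tendsto a).comp hlim
  have h2 := (Complex.continuous_conj.tendsto _).comp h1
  rw [← inner_conj_symm, InnerProductSpace.toDual_symm_apply]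
  refine h2.congr fun n => ?_
  simp [U]

/-- A bounded sublinear map grows at most linearly, with arbitrarily small slope. -/
theorem exists_norm_le_mul_add_of_sublinear {E F : Type*} [NormedAddCommGroup E]
    [NormedAddCommGroup F] {N : E → F}
    (hNbdd : ∀ s : Set E, Bornology.IsBounded s → Bornology.IsBounded (N '' s))
    (hNsub : ∀ u : ℕ → E, Tendsto (fun k => ‖u k‖) atTop atTop →
      Tendsto (fun k => ‖N (u k)‖ / ‖u k‖) atTop (𝓝 (0 : ℝ))) {κ : ℝ} (hκ : 0 < κ) :
    ∃ C, 0 ≤ C ∧ ∀ u, ‖N u‖ ≤ κ * ‖u‖ + C := by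
  have hlarge : ∃ n : ℕ, ∀ u, n + 1 ≤ ‖u‖ → ‖N u‖ ≤ κ * ‖u‖ := by
    by_contra! hcon
    choose u hu hNu using hcon
    have hun : Tendsto (fun k => ‖u k‖) atTop atTop :=
      tendsto_atTop_mono (fun k => (le_add_of_nonneg_right zero_le_one).trans (hu k))
        tendsto_natCast_atTop_atTop
    obtain ⟨k, hk⟩ := ((hNsub u hun).eventually (gt_mem_nhds hκ)).exists
    have hpos : 0 < ‖u k‖ := lt_of_lt_of_le (by positivity) (hu k)
    rw [div_lt_iff₀ hpos] at hk
    exact lt_asymm hk (hNu k)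
  obtain ⟨n, hn⟩ := hlarge
  obtain ⟨C, hC0, hC⟩ :=
    (hNbdd _ (Metric.isBounded_closedBall (x := (0 : E)) (r := n + 1))).exists_pos_norm_le
  refine ⟨C, hC0.le, fun u => ?_⟩
  rcases le_total (n + 1 : ℝ) ‖u‖ with h | h
  · linarith [hn u h]
  · have h1 := hC (N u) ⟨u, by simpa using h, rfl⟩
    have : 0 ≤ κ * ‖u‖ := by positivity
    linarith

/-- Solvability of the Galerkin equations on a finite-dimensional subspace. -/
theorem exists_galerkin_solution (V : Submodule ℂ H) [FiniteDimensional ℂ V] (A : V →ₗ[ℂ] H)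
    {N : H → H} (hN : ∀ (u : ℕ → H) (u₀ : H), Tendsto u atTop (𝓝 u₀) →
      ∀ v : H, Tendsto (fun k => ⟪v, N (u k)⟫_ℂ) atTop (𝓝 ⟪v, N u₀⟫_ℂ))
    {h : H} {M R : ℝ} (hM : 0 ≤ M) (hR : 0 < R)
    (hA : ∀ u : V, ‖u‖ ≤ M * ‖V.starProjection (A u)‖)
    (hNR : ∀ u, ‖u‖ ≤ R → M * ‖h - N u‖ ≤ R) :
    ∃ u : V, ‖u‖ ≤ R ∧ ∀ v ∈ V, ⟪v, A u + N u - h⟫_ℂ = 0 := by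
  let : InnerProductSpace ℝ V := InnerProductSpace.rclikeToReal ℂ V
  have : FiniteDimensional ℝ V := FiniteDimensional.complexToReal V
  let T : V →ₗ[ℂ] V := V.orthogonalProjectionOnto.toLinearMap ∘ₗ A
  have hT : ∀ u, ‖u‖ ≤ M * ‖T u‖ := hA
  have hinj : Function.Injective T := by
    rw [injective_iff_map_eq_zero]
    intro u hu
    have := hT u
    rw [hu, norm_zero, mul_zero] at this
    exact norm_le_zero_iff.1 this
  let e : V ≃ₗ[ℂ] V := LinearEquiv.ofInjectiveEndo T hinj
  have hF : Continuous fun u : V => V.orthogonalProjectionOnto (h - N u) := by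
    rw [continuous_iff_seqContinuous]
    intro u u₀ hu
    rw [tendsto_subtype_rng]
    refine V.tendsto_starProjection_of_tendsto_inner fun v => ?_
    simp_rw [inner_sub_right]
    exact tendsto_const_nhds.sub
      (hN _ _ ((continuous_subtype_val.tendsto u₀).comp hu) v)
  have he : Continuous e.symm := e.symm.toLinearMap.continuous_of_finiteDimensional
  obtain ⟨u, hu, hfix⟩ := exists_fixedPoint_of_mapsTo_closedBall
    (f := fun u : V => e.symm (V.orthogonalProjectionOnto (h - N u))) hR (he.comp hF) fun u hu => by
      refine (hT _).trans (le_trans ?_ (hNR u hu))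
      have : T (e.symm (V.orthogonalProjectionOnto (h - N u))) =
          V.orthogonalProjectionOnto (h - N u) :=
        e.apply_symm_apply _
      rw [this]
      gcongr
      exact V.norm_orthogonalProjectionOnto_apply_le _
  refine ⟨u, hu, fun v hv => ?_⟩
  have h1 : V.orthogonalProjectionOnto (A u) = V.orthogonalProjectionOnto (h - N u) := by
    have h2 : e u = V.orthogonalProjectionOnto (h - N u) := by
      conv_lhs => rw [← hfix]
      exact e.apply_symm_apply _
    exact h2
  have h3 : V.orthogonalProjectionOnto (A u + N u - h) = 0 := by
    rw [show A u + N u - h = A u - (h - N u) by abel, map_sub, h1, sub_self]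
  exact Submodule.inner_right_of_mem_orthogonal hv
    (Submodule.orthogonalProjectionOnto_eq_zero_iff.1 h3)

/-- A bounded sequence of Galerkin solutions yields a solution of `A u + N u = h`, when `A` is
self-adjoint and satisfies a Gårding inequality modulo a finite rank projection and `N` is
demicontinuous and quasi-monotone. -/
theorem exists_solution_of_galerkin_sequence [CompleteSpace H] [TopologicalSpace.SeparableSpace H]
    {dom : Submodule ℂ H} (A : dom →ₗ[ℂ] H)
    (hsymm : ∀ u v : dom, ⟪A u, (v : H)⟫_ℂ = ⟪(u : H), A v⟫_ℂ)
    (hmax : ∀ v w : H, (∀ u : dom, ⟪v, A u⟫_ℂ = ⟪w, (u : H)⟫_ℂ) → ∃ hv : v ∈ dom, A ⟨v, hv⟩ = w)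
    (K : Submodule ℂ H) [FiniteDimensional ℂ K] {c d : ℝ} (hc : 0 < c)
    (hgard : ∀ u : dom, c * ‖u‖ ^ 2 - d * ‖K.starProjection u‖ ^ 2 ≤ (⟪A u, (u : H)⟫_ℂ).re)
    {N : H → H}
    (hNdemi : ∀ (u : ℕ → H) (u₀ : H), Tendsto u atTop (𝓝 u₀) →
      ∀ v : H, Tendsto (fun k => ⟪v, N (u k)⟫_ℂ) atTop (𝓝 ⟪v, N u₀⟫_ℂ))
    (hNqm : ∀ (u : ℕ → H) (u₀ : H),
      (∀ v : H, Tendsto (fun k => ⟪v, u k⟫_ℂ) atTop (𝓝 ⟪v, u₀⟫_ℂ)) →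
      (0 : EReal) ≤ Filter.limsup (fun k => (((⟪N (u k), u k - u₀⟫_ℂ).re : ℝ) : EReal)) atTop)
    {h : H} {u : ℕ → dom} {R C : ℝ} (hu : ∀ n, ‖u n‖ ≤ R) (hNu : ∀ n, ‖N (u n)‖ ≤ C)
    {D : Set dom} (hD : ∀ v : dom, ∀ η > 0, ∃ v' ∈ D, ‖v - v'‖ < η ∧ ‖A (v - v')‖ < η)
    (hGD : ∀ v ∈ D, ∀ᶠ n in atTop, ⟪(v : H), A (u n) + N (u n) - h⟫_ℂ = 0)
    (hGu : ∀ n, ⟪(u n : H), A (u n) + N (u n) - h⟫_ℂ = 0) :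
    ∃ u : dom, A u + N u = h := by
  obtain ⟨u₀, φ, hφ, hφu⟩ := exists_subseq_tendsto_inner (u := fun n => (u n : H)) hu
  obtain ⟨w, ψ, hψ, hψw⟩ := exists_subseq_tendsto_inner fun n => hNu (φ n)
  have hθ : Tendsto (φ ∘ ψ) atTop atTop := hφ.tendsto_atTop.comp hψ.tendsto_atTop
  obtain ⟨x, hx⟩ : ∃ x : ℕ → dom, x = fun n => u (φ (ψ n)) := ⟨_, rfl⟩
  have hxb : ∀ n, ‖x n‖ ≤ R := fun n => by rw [hx]; exact hu _
  have hNxb : ∀ n, ‖N (x n)‖ ≤ C := fun n => by rw [hx]; exact hNu _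
  have hxu : ∀ v : H, Tendsto (fun n => ⟪v, (x n : H)⟫_ℂ) atTop (𝓝 ⟪v, u₀⟫_ℂ) := fun v => by
    rw [hx]; exact (hφu v).comp hψ.tendsto_atTop
  have hxw : ∀ v : H, Tendsto (fun n => ⟪v, N (x n)⟫_ℂ) atTop (𝓝 ⟪v, w⟫_ℂ) := by
    rw [hx]; exact hψw
  have hxD : ∀ v ∈ D, ∀ᶠ n in atTop, ⟪(v : H), A (x n) + N (x n) - h⟫_ℂ = 0 := by
    rw [hx]; exact fun v hv => hθ.eventually (hGD v hv)
  have hxx : ∀ n, ⟪(x n : H), A (x n) + N (x n) - h⟫_ℂ = 0 := by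
    rw [hx]; exact fun n => hGu _
  have hlimD : ∀ v ∈ D, ⟪A v, u₀⟫_ℂ = ⟪(v : H), h - w⟫_ℂ := by
    intro v hv
    refine tendsto_nhds_unique (hxu (A v)) ?_
    have h1 : Tendsto (fun n => ⟪(v : H), h - N (x n)⟫_ℂ) atTop (𝓝 ⟪(v : H), h - w⟫_ℂ) := by
      simp_rw [inner_sub_right]
      exact tendsto_const_nhds.sub (hxw v)
    refine h1.congr' ?_
    filter_upwards [hxD v hv] with n hn
    rw [hsymm, ← sub_eq_zero, ← inner_sub_right, ← neg_eq_zero, ← inner_neg_right, ← hn]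
    congr 1
    abel
  have hlim : ∀ v : dom, ⟪u₀, A v⟫_ℂ = ⟪h - w, (v : H)⟫_ℂ := by
    intro v
    rw [← inner_conj_symm, ← inner_conj_symm (h - w)]
    congr 1
    rw [← sub_eq_zero, ← norm_le_zero_iff]
    refine le_of_forall_pos_le_add fun η hη => ?_
    have hS : 0 < ‖u₀‖ + ‖h - w‖ + 1 := by positivity
    obtain ⟨v', hv', h1, h2⟩ := hD v (η / (‖u₀‖ + ‖h - w‖ + 1)) (by positivity)
    have h3 : ⟪A v, u₀⟫_ℂ - ⟪(v : H), h - w⟫_ℂ =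
        ⟪A (v - v'), u₀⟫_ℂ - ⟪((v - v' : dom) : H), h - w⟫_ℂ := by
      rw [map_sub, inner_sub_left, hlimD v' hv', Submodule.coe_sub, inner_sub_left]
      ring
    rw [h3, zero_add]
    calc _ ≤ ‖A (v - v')‖ * ‖u₀‖ + ‖v - v'‖ * ‖h - w‖ :=
          (norm_sub_le _ _).trans (add_le_add (norm_inner_le_norm _ _) (norm_inner_le_norm _ _))
      _ ≤ η / (‖u₀‖ + ‖h - w‖ + 1) * ‖u₀‖ + η / (‖u₀‖ + ‖h - w‖ + 1) * ‖h - w‖ := by gcongr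
      _ ≤ η / (‖u₀‖ + ‖h - w‖ + 1) * (‖u₀‖ + ‖h - w‖ + 1) := by
          have : 0 < η / (‖u₀‖ + ‖h - w‖ + 1) := by positivity
          nlinarith
      _ = η := div_mul_cancel₀ _ hS.ne'
  obtain ⟨hu₀, hAu₀⟩ := hmax _ _ hlim
  set y : dom := ⟨u₀, hu₀⟩ with hy
  have hupper : ∀ η > 0, ∀ᶠ n in atTop,
      (⟪N (x n), x n - u₀⟫_ℂ).re + c * ‖x n - y‖ ^ 2 < η := by
    intro η hη
    have hR0 : 0 ≤ R := (norm_nonneg _).trans (hxb 0)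
    have hC0 : 0 ≤ C := (norm_nonneg _).trans (hNxb 0)
    have hS : 0 < ‖h‖ + R + C + 1 := by positivity
    set η' := η / 2 / (‖h‖ + R + C + 1) with hη'
    have hη'0 : 0 < η' := by positivity
    obtain ⟨v', hv', h1, h2⟩ := hD y η' hη'0
    have hPlim : Tendsto (fun n => ‖K.starProjection (x n - u₀)‖) atTop (𝓝 0) := by
      have := (K.tendsto_starProjection_of_tendsto_inner hxu).sub_const (K.starProjection u₀)
      rw [sub_self] at this
      simpa using this.norm
    have hwlim : Tendsto (fun n => (⟪w, x n - u₀⟫_ℂ).re) atTop (𝓝 0) := by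
      have := (hxu w).sub_const ⟪w, u₀⟫_ℂ
      rw [sub_self] at this
      simpa [inner_sub_right, Function.comp_def] using (Complex.continuous_re.tendsto _).comp this
    have hsum : Tendsto (fun n => (⟪w, x n - u₀⟫_ℂ).re + d * ‖K.starProjection (x n - u₀)‖ ^ 2)
        atTop (𝓝 0) := by
      simpa using hwlim.add ((hPlim.pow 2).const_mul d)
    filter_upwards [hxD v' hv', hsum.eventually (gt_mem_nhds (half_pos hη))] with n hn hn2
    have hz : ⟪A (x n) + N (x n) - h, (x n : H) - v'⟫_ℂ = 0 := by
      rw [← inner_conj_symm, inner_sub_left, hxx, hn, sub_zero, map_zero]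
    have hg := hgard (x n - y)
    have hid : ⟪N (x n), (x n : H) - u₀⟫_ℂ = ⟪w, (x n : H) - u₀⟫_ℂ
        - ⟪A (x n - y), ((x n - y : dom) : H)⟫_ℂ + (⟪h, ((y - v' : dom) : H)⟫_ℂ
        - ⟪(x n : H), A (y - v')⟫_ℂ - ⟪N (x n), ((y - v' : dom) : H)⟫_ℂ) := by
      have hw : w = h - A y := by rw [hAu₀]; abel
      rw [← hsymm, hw, map_sub A (x n) y]
      have hyu : (y : H) = u₀ := rfl
      simp only [Submodule.coe_sub, hyu, inner_sub_left, inner_sub_right, inner_add_left] at hz ⊢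
      linear_combination hz
    have hrest : (⟪h, ((y - v' : dom) : H)⟫_ℂ - ⟪(x n : H), A (y - v')⟫_ℂ
        - ⟪N (x n), ((y - v' : dom) : H)⟫_ℂ).re ≤ η / 2 := by
      refine (Complex.re_le_norm _).trans ?_
      calc _ ≤ ‖h‖ * ‖y - v'‖ + ‖x n‖ * ‖A (y - v')‖ + ‖N (x n)‖ * ‖y - v'‖ :=
            (norm_sub_le _ _).trans (add_le_add ((norm_sub_le _ _).trans
              (add_le_add (norm_inner_le_norm _ _) (norm_inner_le_norm _ _)))
              (norm_inner_le_norm _ _))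
        _ ≤ ‖h‖ * η' + R * η' + C * η' := by
            gcongr
            exacts [hxb n, hNxb n]
        _ ≤ η' * (‖h‖ + R + C + 1) := by linarith
        _ = η / 2 := div_mul_cancel₀ _ hS.ne'
    rw [hid]
    simp only [Complex.add_re, Complex.sub_re] at hrest ⊢
    have hcoe : ((x n - y : dom) : H) = x n - u₀ := rfl
    rw [hcoe] at hg ⊢
    linarith
  have hclus : MapClusterPt u₀ atTop fun n => (x n : H) := by
    rw [mapClusterPt_iff_frequently]
    intro s hs
    obtain ⟨ρ, hρ, hρs⟩ := Metric.mem_nhds_iff.1 hs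
    have hη : 0 < c * ρ ^ 2 / 2 := by positivity
    have hlow : ∃ᶠ n in atTop, -(c * ρ ^ 2 / 2) < (⟪N (x n), x n - u₀⟫_ℂ).re := by
      have := Filter.frequently_lt_of_lt_limsup
        (b := ((-(c * ρ ^ 2 / 2) : ℝ) : EReal)) (by isBoundedDefault)
        (lt_of_lt_of_le (by exact_mod_cast neg_lt_zero.2 hη) (hNqm _ _ hxu))
      exact this.mono fun n hn => by exact_mod_cast hn
    refine (hlow.and_eventually (hupper _ hη)).mono fun n hn => hρs ?_
    rw [Metric.mem_ball, dist_eq_norm]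
    have h1 : c * ‖x n - y‖ ^ 2 < c * ρ ^ 2 := by linarith [hn.1, hn.2]
    exact lt_of_pow_lt_pow_left₀ 2 hρ.le (lt_of_mul_lt_mul_left h1 hc.le)
  obtain ⟨χ, hχ, hχlim⟩ := hclus.tendsto_subseq
  have hwN : w = N u₀ := ext_inner_left ℂ fun v =>
    tendsto_nhds_unique ((hxw v).comp hχ.tendsto_atTop) (hNdemi _ _ hχlim v)
  exact ⟨y, by rw [hAu₀, hwN]; exact sub_add_cancel _ _⟩

theorem Submodule.norm_sq_eq_norm_sq_starProjection_add (K : Submodule ℂ H)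
    [K.HasOrthogonalProjection] (u : H) :
    ‖u‖ ^ 2 = ‖K.starProjection u‖ ^ 2 + ‖u - K.starProjection u‖ ^ 2 := by
  have h := norm_add_sq_eq_norm_sq_add_norm_sq_of_inner_eq_zero (𝕜 := ℂ) (K.starProjection u)
    (u - K.starProjection u) (Submodule.inner_right_of_mem_orthogonal
      (K.starProjection_apply_mem u) (K.sub_starProjection_mem_orthogonal u))
  rw [add_sub_cancel] at h
  simpa [sq] using h

/-- Solvability of `A u + N u = h` for a self-adjoint operator `A` which is bounded below on a
finite-dimensional invariant subspace `K` and strongly positive on `Kᗮ`. -/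
theorem exists_solution_of_orthogonal_decomposition [CompleteSpace H]
    [TopologicalSpace.SeparableSpace H] {dom : Submodule ℂ H} (A : dom →ₗ[ℂ] H)
    (hsymm : ∀ u v : dom, ⟪A u, (v : H)⟫_ℂ = ⟪(u : H), A v⟫_ℂ)
    (hmax : ∀ v w : H, (∀ u : dom, ⟪v, A u⟫_ℂ = ⟪w, (u : H)⟫_ℂ) → ∃ hv : v ∈ dom, A ⟨v, hv⟩ = w)
    (K : Submodule ℂ H) [FiniteDimensional ℂ K] (hK : K ≤ dom) {γ δ ε : ℝ} (hδ : 0 < δ)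
    (hε : 0 < ε) (hAK : ∀ u : dom, (u : H) ∈ K → A u ∈ K)
    (hAKo : ∀ u : dom, (u : H) ∈ Kᗮ → A u ∈ Kᗮ)
    (hlow : ∀ u : dom, (u : H) ∈ K → δ * ‖u‖ ≤ ‖A u‖)
    (hcoer : ∀ u : dom, (u : H) ∈ K → -γ * ‖u‖ ^ 2 ≤ (⟪A u, (u : H)⟫_ℂ).re)
    (hcoero : ∀ u : dom, (u : H) ∈ Kᗮ → ε * ‖u‖ ^ 2 ≤ (⟪A u, (u : H)⟫_ℂ).re)
    {N : H → H} (hNbdd : ∀ s : Set H, Bornology.IsBounded s → Bornology.IsBounded (N '' s))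
    (hNdemi : ∀ (u : ℕ → H) (u₀ : H), Tendsto u atTop (𝓝 u₀) →
      ∀ v : H, Tendsto (fun k => ⟪v, N (u k)⟫_ℂ) atTop (𝓝 ⟪v, N u₀⟫_ℂ))
    (hNqm : ∀ (u : ℕ → H) (u₀ : H),
      (∀ v : H, Tendsto (fun k => ⟪v, u k⟫_ℂ) atTop (𝓝 ⟪v, u₀⟫_ℂ)) →
      (0 : EReal) ≤ Filter.limsup (fun k => (((⟪N (u k), u k - u₀⟫_ℂ).re : ℝ) : EReal)) atTop)
    (hNsub : ∀ u : ℕ → H, Tendsto (fun k => ‖u k‖) atTop atTop →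
      Tendsto (fun k => ‖N (u k)‖ / ‖u k‖) atTop (𝓝 (0 : ℝ))) (h : H) :
    ∃ u : dom, A u + N u = h := by
  let p : dom → dom := fun u => ⟨K.starProjection u, hK (K.starProjection_apply_mem u)⟩
  have hp : ∀ u, (p u : H) ∈ K := fun u => K.starProjection_apply_mem u
  have hq : ∀ u, ((u - p u : dom) : H) ∈ Kᗮ := fun u => K.sub_starProjection_mem_orthogonal _
  have hpyth : ∀ u : dom, ‖u‖ ^ 2 = ‖p u‖ ^ 2 + ‖u - p u‖ ^ 2 := fun u =>
    K.norm_sq_eq_norm_sq_starProjection_add u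
  have hAdec : ∀ u, A u = A (p u) + A (u - p u) := fun u => by
    rw [← map_add, add_sub_cancel]
  have hKo : ∀ {x y : H}, x ∈ K → y ∈ Kᗮ → ⟪x, y⟫_ℂ = 0 := fun hx hy =>
    Submodule.inner_right_of_mem_orthogonal hx hy
  have hoK : ∀ {x y : H}, x ∈ K → y ∈ Kᗮ → ⟪y, x⟫_ℂ = 0 := fun hx hy =>
    Submodule.inner_left_of_mem_orthogonal hx hy
  have hgard : ∀ u : dom, ε * ‖u‖ ^ 2 - (ε + γ) * ‖K.starProjection u‖ ^ 2 ≤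
      (⟪A u, (u : H)⟫_ℂ).re := by
    intro u
    have h1 : ⟪A u, (u : H)⟫_ℂ =
        ⟪A (p u), (p u : H)⟫_ℂ + ⟪A (u - p u), ((u - p u : dom) : H)⟫_ℂ := by
      have hu : (u : H) = p u + (u - p u : dom) := by simp
      conv_lhs => rw [hAdec u, hu]
      rw [inner_add_left, inner_add_right, inner_add_right,
        hKo (hAK _ (hp u)) (hq u), hoK (hp u) (hAKo _ (hq u)), add_zero, zero_add]
    have h2 : ‖K.starProjection (u : H)‖ = ‖p u‖ := rfl
    rw [h1, Complex.add_re, hpyth u, h2]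
    linarith [hcoer _ (hp u), hcoero _ (hq u)]
  have hbelow : ∀ (V : Submodule ℂ H) [FiniteDimensional ℂ V], K ≤ V → ∀ u : dom,
      (u : H) ∈ V → ‖u‖ ≤ (1 / δ + 1 / ε) * ‖V.starProjection (A u)‖ := by
    intro V _ hKV u hu
    set z := V.starProjection (A u) with hz
    have hzV : ∀ v ∈ V, ⟪v, z⟫_ℂ = ⟪v, A u⟫_ℂ := fun v hv => by
      have h1 := Submodule.inner_right_of_mem_orthogonal hv
        (V.sub_starProjection_mem_orthogonal (A u))
      rw [inner_sub_right, sub_eq_zero] at h1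
      exact h1.symm
    have h1 : ‖A (p u)‖ ≤ ‖z‖ := by
      have h2 : ⟪A (p u), z⟫_ℂ = ⟪A (p u), A (p u)⟫_ℂ := by
        rw [hzV _ (hKV (hAK _ (hp u))), hAdec u, inner_add_right,
          hKo (hAK _ (hp u)) (hAKo _ (hq u)), add_zero]
      have h3 := norm_inner_le_norm (𝕜 := ℂ) (A (p u)) z
      rw [h2, ← inner_self_re_eq_norm, inner_self_eq_norm_mul_norm] at h3
      by_contra! hlt
      nlinarith [norm_nonneg z]
    have h4 : ε * ‖u - p u‖ ≤ ‖z‖ := by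
      have h2 : ⟪((u - p u : dom) : H), z⟫_ℂ = ⟪((u - p u : dom) : H), A (u - p u)⟫_ℂ := by
        rw [hzV ((u - p u : dom) : H) (V.sub_mem hu (hKV (hp u))), hAdec u, inner_add_right,
          hoK (hAK _ (hp u)) (hq u), zero_add]
      have h3 := norm_inner_le_norm (𝕜 := ℂ) ((u - p u : dom) : H) z
      rw [h2, ← hsymm] at h3
      have h5 := (hcoero _ (hq u)).trans (Complex.re_le_norm _)
      have h6 : ‖((u - p u : dom) : H)‖ = ‖u - p u‖ := rfl
      rw [h6] at h3
      by_contra! hlt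
      have h7 : 0 < ‖u - p u‖ := by
        by_contra! h0
        nlinarith [norm_nonneg z]
      nlinarith
    have h5 : ‖p u‖ ≤ 1 / δ * ‖z‖ := by
      rw [one_div, ← div_eq_inv_mul, le_div_iff₀ hδ, mul_comm]
      exact (hlow _ (hp u)).trans h1
    have h6 : ‖u - p u‖ ≤ 1 / ε * ‖z‖ := by
      rw [one_div, ← div_eq_inv_mul, le_div_iff₀ hε, mul_comm]
      exact h4
    have h7 := norm_le_norm_add_norm_sub' u (p u)
    linarith
  obtain ⟨M, hM⟩ : ∃ M, M = 1 / δ + 1 / ε := ⟨_, rfl⟩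
  have hM0 : 0 < M := by rw [hM]; positivity
  rw [← hM] at hbelow
  obtain ⟨C, hC0, hC⟩ := exists_norm_le_mul_add_of_sublinear hNbdd hNsub
    (κ := 1 / (2 * M)) (by positivity)
  obtain ⟨R, hR⟩ : ∃ R, R = 2 * M * (‖h‖ + C) + 1 := ⟨_, rfl⟩
  have hR0 : 0 < R := by rw [hR]; positivity
  have hNR : ∀ u, ‖u‖ ≤ R → M * ‖h - N u‖ ≤ R := by
    intro u hu
    have h1 : ‖h - N u‖ ≤ ‖h‖ + (1 / (2 * M) * ‖u‖ + C) :=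
      (norm_sub_le _ _).trans (by gcongr; exact hC u)
    have h2 : M * (1 / (2 * M) * ‖u‖) = ‖u‖ / 2 := by field_simp
    have h3 := mul_le_mul_of_nonneg_left h1 hM0.le
    linarith
  have : SecondCountableTopology H := UniformSpace.secondCountable_of_separable H
  let graph : Set (H × H) := Set.range fun v : dom => ((v : H), A v)
  have : Nonempty graph := ⟨⟨_, 0, rfl⟩⟩
  obtain ⟨e, he⟩ := TopologicalSpace.exists_dense_seq graph
  have hev : ∀ n, ∃ v : dom, ((v : H), A v) = (e n : H × H) := fun n => (e n).2
  choose g hg using hev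
  let V : ℕ → Submodule ℂ H := fun n => K ⊔ Submodule.span ℂ ((fun k => (g k : H)) '' Set.Iio n)
  have hVfd : ∀ n, FiniteDimensional ℂ (V n) := fun n => by
    have := FiniteDimensional.span_of_finite ℂ ((Set.finite_Iio n).image fun k => (g k : H))
    exact Submodule.finiteDimensional_sup _ _
  have hVmono : Monotone V := fun m n hmn =>
    sup_le_sup_left (Submodule.span_mono (Set.image_mono (Set.Iio_subset_Iio hmn))) _
  have hVdom : ∀ n, V n ≤ dom := fun n => by
    refine sup_le hK (Submodule.span_le.2 ?_)
    rintro _ ⟨k, -, rfl⟩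
    exact (g k).2
  have hgal : ∀ n, ∃ u : V n, ‖u‖ ≤ R ∧
      ∀ v ∈ V n, ⟪v, A (Submodule.inclusion (hVdom n) u) + N u - h⟫_ℂ = 0 := fun n =>
    exists_galerkin_solution (V n) (A ∘ₗ Submodule.inclusion (hVdom n)) hNdemi hM0.le hR0
      (fun u => hbelow (V n) le_sup_left (Submodule.inclusion (hVdom n) u) u.2) hNR
  choose u huR hu using hgal
  refine exists_solution_of_galerkin_sequence A hsymm hmax K hε hgard hNdemi hNqm
    (u := fun n => Submodule.inclusion (hVdom n) (u n)) (C := 1 / (2 * M) * R + C)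
    (D := Set.range g) huR (fun n => (hC _).trans ?_) ?_ ?_ fun n => hu n _ (u n).2
  · gcongr
    exact huR n
  · intro v η hη
    obtain ⟨n, hn⟩ := he.exists_dist_lt (⟨_, v, rfl⟩ : graph) hη
    rw [Subtype.dist_eq, ← hg n, Prod.dist_eq, max_lt_iff, dist_eq_norm, dist_eq_norm,
      ← map_sub] at hn
    exact ⟨g n, ⟨n, rfl⟩, hn⟩
  · rintro _ ⟨k, rfl⟩
    filter_upwards [eventually_gt_atTop k] with n hn
    exact hu n _ (le_sup_right (a := K) (Submodule.subset_span ⟨k, hn, rfl⟩))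

end HilbertSpace

/-- (Finite-dimensional-negative-part setting.) `H` is a complex separable
Hilbert space, `H = H₁ ⊕ H₁ᗮ` with `H₁` finite-dimensional and `P₁` the orthogonal projection
onto `H₁`; `L` is a densely defined self-adjoint operator with `H₁ ⊆ dom L`, leaving `H₁` and
`H₁ᗮ` invariant, with `‖Lu₁‖ ≥ δ‖u₁‖`, `Re⟪Lu₁, u₁⟫ ≥ −γ‖u₁‖²` on `H₁` (`γ ≥ δ > 0`) and
`Re⟪Lu₂, u₂⟫ ≥ 0` on `dom L ∩ H₁ᗮ`. If `N` is bounded, demicontinuous, quasi-monotone and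
sublinear, then for every `0 < ε < 1` and `h ∈ H` the perturbed equation
`ε P₂u + Lu + N(u) = h` has a solution in `dom L`. -/
theorem stmt_8 {H : Type*} [NormedAddCommGroup H] [InnerProductSpace ℂ H] [CompleteSpace H]
    [TopologicalSpace.SeparableSpace H]
    (H₁ dom : Submodule ℂ H) (hfd : FiniteDimensional ℂ H₁)
    (hdense : Dense (dom : Set H)) (hH₁dom : H₁ ≤ dom)
    (P₁ : H → H) (hP₁mem : ∀ u : H, P₁ u ∈ H₁) (hP₁orth : ∀ u : H, u - P₁ u ∈ H₁ᗮ)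
    (L : H → H)
    (hlin : ∀ u ∈ dom, ∀ v ∈ dom, ∀ a b : ℂ, L (a • u + b • v) = a • L u + b • L v)
    (hsymm : ∀ u ∈ dom, ∀ v ∈ dom, (inner ℂ (L u) v : ℂ) = inner ℂ u (L v))
    (hselfadj : ∀ v w : H, (∀ u ∈ dom, (inner ℂ v (L u) : ℂ) = inner ℂ w u) → v ∈ dom ∧ L v = w)
    (hinv₁ : ∀ u ∈ H₁, L u ∈ H₁)
    (hinv₂ : ∀ u ∈ dom, u ∈ H₁ᗮ → L u ∈ H₁ᗮ)
    (γ δ : ℝ) (hδ : 0 < δ) (hγδ : δ ≤ γ)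
    (hlow : ∀ u ∈ H₁, δ * ‖u‖ ≤ ‖L u‖)
    (hcoer₁ : ∀ u ∈ H₁, -γ * ‖u‖ ^ 2 ≤ (inner ℂ (L u) u : ℂ).re)
    (hnn₂ : ∀ u ∈ dom, u ∈ H₁ᗮ → 0 ≤ (inner ℂ (L u) u : ℂ).re)
    (N : H → H)
    (hNbdd : ∀ s : Set H, Bornology.IsBounded s → Bornology.IsBounded (N '' s))
    (hNdemi : ∀ (u : ℕ → H) (u₀ : H), Tendsto u atTop (𝓝 u₀) →
      ∀ v : H, Tendsto (fun k => (inner ℂ v (N (u k)) : ℂ)) atTop (𝓝 (inner ℂ v (N u₀))))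
    (hNqm : ∀ (u : ℕ → H) (u₀ : H),
      (∀ v : H, Tendsto (fun k => (inner ℂ v (u k) : ℂ)) atTop (𝓝 (inner ℂ v u₀))) →
      (0 : EReal) ≤
        Filter.limsup (fun k => (((inner ℂ (N (u k)) (u k - u₀) : ℂ).re : ℝ) : EReal)) atTop)
    (hNsub : ∀ u : ℕ → H, Tendsto (fun k => ‖u k‖) atTop atTop →
      Tendsto (fun k => ‖N (u k)‖ / ‖u k‖) atTop (𝓝 (0 : ℝ)))
    (ε : ℝ) (hε₀ : 0 < ε) (hε₁ : ε < 1) (h : H) :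
    ∃ u ∈ dom, (ε : ℂ) • (u - P₁ u) + L u + N u = h := by
  have hP : ∀ u, P₁ u = H₁.starProjection u := fun u =>
    (Submodule.eq_starProjection_of_mem_orthogonal (hP₁mem u) (hP₁orth u)).symm
  let L' : dom →ₗ[ℂ] H :=
    { toFun := fun u => L u
      map_add' := fun u v => by simpa using hlin u u.2 v v.2 1 1
      map_smul' := fun c u => by simpa using hlin u u.2 u u.2 c 0 }
  let A : dom →ₗ[ℂ] H :=
    (ε : ℂ) • (LinearMap.id - H₁.starProjection.toLinearMap) ∘ₗ dom.subtype + L'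
  have hA : ∀ u : dom, A u = (ε : ℂ) • ((u : H) - H₁.starProjection u) + L u := fun _ => rfl
  have hPsymm : ∀ u v : H, (inner ℂ ((ε : ℂ) • (u - H₁.starProjection u)) v : ℂ) =
      inner ℂ u ((ε : ℂ) • (v - H₁.starProjection v)) := fun u v => by
    simp [H₁.inner_starProjection_left_eq_right]
  have hAK : ∀ u : dom, (u : H) ∈ H₁ → A u = L u := fun u hu => by
    rw [hA, Submodule.starProjection_eq_self_iff.2 hu, sub_self, smul_zero, zero_add]
  have hAKo : ∀ u : dom, (u : H) ∈ H₁ᗮ → A u = (ε : ℂ) • (u : H) + L u := fun u hu => by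
    rw [hA, H₁.starProjection_apply_eq_zero_iff.2 hu, sub_zero]
  obtain ⟨u, hu⟩ := exists_solution_of_orthogonal_decomposition A
    (fun u v => by
      rw [hA, hA, inner_add_left, inner_add_right, hPsymm, hsymm u u.2 v v.2])
    (fun v w hvw => by
      obtain ⟨hv, hLv⟩ := hselfadj v (w - (ε : ℂ) • (v - H₁.starProjection v)) fun u hu => by
        have h1 := hvw ⟨u, hu⟩
        rw [hA, inner_add_right, ← hPsymm] at h1
        rw [inner_sub_left, ← h1]
        ring
      exact ⟨hv, by rw [hA, hLv]; exact add_sub_cancel _ _⟩)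
    H₁ hH₁dom hδ hε₀ (γ := γ)
    (fun u hu => by rw [hAK u hu]; exact hinv₁ u hu)
    (fun u hu => by
      rw [hAKo u hu]
      exact Submodule.add_mem _ (Submodule.smul_mem _ _ hu) (hinv₂ u u.2 hu))
    (fun u hu => by rw [hAK u hu]; exact hlow u hu)
    (fun u hu => by rw [hAK u hu]; exact hcoer₁ u hu)
    (fun u hu => by
      have h1 : (inner ℂ ((ε : ℂ) • (u : H)) (u : H) : ℂ).re = ε * ‖u‖ ^ 2 := by
        rw [inner_smul_left, inner_self_eq_norm_sq_to_K, Complex.conj_ofReal]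
        norm_cast
        exact Complex.re_ofReal_mul _ _
      rw [hAKo u hu, inner_add_left, Complex.add_re, h1]
      linarith [hnn₂ u u.2 hu])
    hNbdd hNdemi hNqm hNsub h
  exact ⟨u, u.2, by rw [hP, ← hA]; exact hu⟩
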